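/- Let 0 < α < 1. Define, for τ ∈ (0,∞), w̄_α(τ) = (1/π) Σ_{n=1}^∞ (−1)^{n−1} τ^{−nα−1} (Γ(nα+1)/n!) sin(nπα), and ξ_α(τ) = (1/α) τ^{−1−1/α} w̄_α(τ^{−1/α}). Then ξ_α is a probability density function on (0,∞): ξ_α(τ) ≥ 0 for all τ ∈ (0,∞), and ∫₀^∞ ξ_α(τ) dτ = 1. -/

import Mathlib

open MeasureTheory Real

/-- The Wright-type function
`w̄_α(τ) = (1/π) Σ_{n=1}^∞ (−1)^{n−1} τ^{−nα−1} (Γ(nα+1)/n!) sin(nπα)`. -/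
noncomputable def wbar (α τ : ℝ) : ℝ :=
  (1 / π) * ∑' n : ℕ,
    (-1 : ℝ) ^ n * τ ^ (-(((n : ℝ) + 1) * α) - 1) *
      (Real.Gamma (((n : ℝ) + 1) * α + 1) / (Nat.factorial (n + 1))) *
      Real.sin (((n : ℝ) + 1) * π * α)

/-- The Mainardi-type function `ξ_α(τ) = (1/α) τ^{−1−1/α} w̄_α(τ^{−1/α})`. -/
noncomputable def xiα (α τ : ℝ) : ℝ :=
  (1 / α) * τ ^ (-1 - 1 / α) * wbar α (τ ^ (-(1 / α)))

open Filter Topology Set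

/-- The coefficients `Γ(nα + 1) / n!` decay fast enough to define an entire function. -/
lemma summable_pow_div_factorial_mul_Gamma {α τ : ℝ} (hα0 : 0 < α) (hα1 : α < 1) (hτ : 0 < τ) :
    Summable fun n : ℕ => τ ^ n / (Nat.factorial n) * Real.Gamma (n * α + 1) := by
  have hfac : ∀ n : ℕ, (0 : ℝ) < Nat.factorial n := fun n => by positivity
  have hsum : Summable fun n : ℕ => τ ^ n / ((Nat.factorial n : ℝ) ^ (1 - α)) := by
    refine summable_of_ratio_test_tendsto_lt_one (l := 0) one_pos
      (Eventually.of_forall fun n => ?_) ?_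
    · have := hfac n
      positivity
    · have h1 : Tendsto (fun n : ℕ => τ * ((n + 1 : ℕ) : ℝ) ^ (-(1 - α))) atTop (𝓝 (τ * 0)) :=
        (((tendsto_rpow_neg_atTop (by linarith : 0 < 1 - α)).comp
          tendsto_natCast_atTop_atTop).comp (tendsto_add_atTop_nat 1)).const_mul τ
      rw [mul_zero] at h1
      refine h1.congr fun n => ?_
      have h2 := hfac n
      have h3 : (0 : ℝ) < ((n + 1 : ℕ) : ℝ) := by positivity
      rw [Real.norm_of_nonneg (by positivity), Real.norm_of_nonneg (by positivity),
        Nat.factorial_succ, Nat.cast_mul, Real.mul_rpow h3.le h2.le, Real.rpow_neg h3.le]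
      have h4 : (0 : ℝ) < ((n + 1 : ℕ) : ℝ) ^ (1 - α) := by positivity
      have h5 : (0 : ℝ) < (Nat.factorial n : ℝ) ^ (1 - α) := by positivity
      field_simp
      ring
  refine hsum.of_nonneg_of_le (fun n => ?_) fun n => ?_
  · have : 0 < Real.Gamma (n * α + 1) := Real.Gamma_pos_of_pos (by positivity)
    positivity
  · have h := Real.Gamma_mul_add_mul_le_rpow_Gamma_mul_rpow_Gamma (s := n + 1) (t := 1)
      (a := α) (b := 1 - α) (by positivity) one_pos hα0 (by linarith) (by ring)
    rw [Real.Gamma_nat_eq_factorial, Real.Gamma_one, Real.one_rpow, mul_one, mul_one,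
      show α * ((n : ℝ) + 1) + (1 - α) = n * α + 1 by ring] at h
    have h2 := hfac n
    calc τ ^ n / (Nat.factorial n) * Real.Gamma (n * α + 1)
        ≤ τ ^ n / (Nat.factorial n) * (Nat.factorial n : ℝ) ^ α := by gcongr
      _ = τ ^ n / ((Nat.factorial n : ℝ) ^ (1 - α)) := by
        rw [Real.rpow_sub h2, Real.rpow_one]
        have h3 : (0 : ℝ) < (Nat.factorial n : ℝ) ^ α := by positivity
        field_simp

/-- Termwise integration of the Hankel integrand along the upper side of the negative half-axis. -/
lemma hasSum_integral_cut {α τ : ℝ} (hα0 : 0 < α) (hα1 : α < 1) (hτ : 0 < τ) :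
    HasSum (fun n : ℕ => (((-τ) ^ n / (Nat.factorial n) * Real.Gamma (n * α + 1) : ℝ) : ℂ) *
        Complex.exp (n * (α * π * Complex.I)))
      (∫ r in Ioi (0 : ℝ), Complex.exp (-r - τ * (r ^ α : ℝ) * Complex.exp (α * π * Complex.I))) := by
  set F : ℕ → ℝ → ℂ := fun n r =>
    (((-τ) ^ n / (Nat.factorial n) * (r ^ (n * α) * Real.exp (-r)) : ℝ) : ℂ) *
      Complex.exp (n * (α * π * Complex.I)) with hF
  have hexp : ∀ n : ℕ, ‖Complex.exp (n * (α * π * Complex.I))‖ = 1 := fun n => by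
    rw [show (n * (α * π * Complex.I) : ℂ) = ((n * (α * π) : ℝ) : ℂ) * Complex.I by push_cast; ring]
    exact Complex.norm_exp_ofReal_mul_I _
  have hG : ∀ n : ℕ, ∫ r in Ioi (0 : ℝ), r ^ (n * α) * Real.exp (-r) =
      Real.Gamma (n * α + 1) := fun n => by
    rw [Real.Gamma_eq_integral (by positivity)]
    refine setIntegral_congr_fun measurableSet_Ioi fun r _ => ?_
    simp [mul_comm]
  have hGi : ∀ n : ℕ, IntegrableOn (fun r : ℝ => r ^ (n * α) * Real.exp (-r)) (Ioi 0) := fun n => by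
    refine (Real.GammaIntegral_convergent (s := n * α + 1) (by positivity)).congr_fun
      (fun r _ => ?_) measurableSet_Ioi
    simp [mul_comm]
  have hinteg : ∀ n, ∫ r in Ioi (0 : ℝ), F n r =
      (((-τ) ^ n / (Nat.factorial n) * Real.Gamma (n * α + 1) : ℝ) : ℂ) *
        Complex.exp (n * (α * π * Complex.I)) := fun n => by
    rw [hF]
    simp only
    rw [integral_mul_const, integral_complex_ofReal, integral_const_mul, hG]
  have hnorm : ∀ n, ∫ r in Ioi (0 : ℝ), ‖F n r‖ =
      τ ^ n / (Nat.factorial n) * Real.Gamma (n * α + 1) := fun n => by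
    rw [← hG, ← integral_const_mul]
    refine setIntegral_congr_fun measurableSet_Ioi fun r (hr : 0 < r) => ?_
    simp only [hF, norm_mul, hexp, mul_one, Complex.norm_real]
    have : 0 < r ^ (n * α) := Real.rpow_pos_of_pos hr _
    rw [norm_div, norm_pow, norm_neg, Real.norm_of_nonneg hτ.le, Real.norm_of_nonneg this.le,
      Real.norm_of_nonneg (Real.exp_pos _).le, Real.norm_of_nonneg (by positivity)]
  have key := hasSum_integral_of_summable_integral_norm (μ := volume.restrict (Ioi (0 : ℝ))) (F := F)
    (fun n => (((hGi n).const_mul _).ofReal).mul_const _)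
    ((summable_pow_div_factorial_mul_Gamma hα0 hα1 hτ).congr fun n => (hnorm n).symm)
  simp only [hinteg] at key
  suffices heq : ∀ r ∈ Ioi (0 : ℝ), ∑' n, F n r =
      Complex.exp (-r - τ * (r ^ α : ℝ) * Complex.exp (α * π * Complex.I)) by
    rwa [setIntegral_congr_fun measurableSet_Ioi heq] at key
  intro r (hr : 0 < r)
  have h := (NormedSpace.expSeries_div_hasSum_exp (𝔸 := ℂ)
    (-(τ * (r ^ α : ℝ) * Complex.exp (α * π * Complex.I)) : ℂ)).mul_left (Complex.exp (-r))
  rw [← Complex.exp_eq_exp_ℂ, ← Complex.exp_add] at h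
  rw [sub_eq_add_neg, ← h.tsum_eq]
  refine tsum_congr fun n => ?_
  simp only [hF]
  rw [show -(τ * (r ^ α : ℝ) * Complex.exp (α * π * Complex.I)) =
    ((-τ : ℝ) : ℂ) * (r ^ α : ℝ) * Complex.exp (α * π * Complex.I) by push_cast; ring, mul_pow,
    mul_pow, ← Complex.exp_nat_mul, mul_comm (n : ℝ) α, Real.rpow_mul hr.le, Real.rpow_natCast]
  push_cast
  ring

/-- `ξ_α` as an integral along the branch cut of `s ^ α`. -/
lemma xiα_eq_im_integral_cut {α τ : ℝ} (hα0 : 0 < α) (hα1 : α < 1) (hτ : 0 < τ) :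
    π * α * τ * xiα α τ =
      -(∫ r in Ioi (0 : ℝ),
        Complex.exp (-r - τ * (r ^ α : ℝ) * Complex.exp (α * π * Complex.I))).im := by
  have h := ((Complex.hasSum_im (hasSum_integral_cut hα0 hα1 hτ)).neg)
  have h1 := (hasSum_nat_add_iff' 1).2 h
  have h2 := h1.tsum_eq
  simp only [Finset.range_one, Finset.sum_singleton, Complex.im_ofReal_mul, Nat.cast_zero, zero_mul,
    Complex.exp_zero, Complex.one_im, mul_zero, neg_zero, sub_zero] at h2
  rw [← h2, xiα, wbar]
  have hπ := Real.pi_pos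
  have h3 : π * α * τ * ((1 / α) * τ ^ (-1 - 1 / α) * ((1 / π) * ∑' n : ℕ,
    (-1 : ℝ) ^ n * (τ ^ (-(1 / α))) ^ (-(((n : ℝ) + 1) * α) - 1) *
      (Real.Gamma (((n : ℝ) + 1) * α + 1) / (Nat.factorial (n + 1))) *
      Real.sin (((n : ℝ) + 1) * π * α))) = (τ * τ ^ (-1 - 1 / α)) * ∑' n : ℕ,
    (-1 : ℝ) ^ n * (τ ^ (-(1 / α))) ^ (-(((n : ℝ) + 1) * α) - 1) *
      (Real.Gamma (((n : ℝ) + 1) * α + 1) / (Nat.factorial (n + 1))) *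
      Real.sin (((n : ℝ) + 1) * π * α) := by
    field_simp
  rw [h3, ← tsum_mul_left]
  refine tsum_congr fun n => ?_
  have h4 : τ * τ ^ (-1 - 1 / α) * (τ ^ (-(1 / α))) ^ (-(((n : ℝ) + 1) * α) - 1) = τ ^ (n + 1) := by
    rw [← Real.rpow_mul hτ.le, ← Real.rpow_natCast]
    nth_rewrite 1 [← Real.rpow_one τ]
    rw [← Real.rpow_add hτ, ← Real.rpow_add hτ]
    congr 1
    push_cast
    field_simp
    ring
  have h5 : (Complex.exp ((n + 1 : ℕ) * (α * π * Complex.I))).im =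
      Real.sin (((n : ℝ) + 1) * π * α) := by
    rw [show ((n + 1 : ℕ) * (α * π * Complex.I) : ℂ) =
      (((n + 1) * π * α : ℝ) : ℂ) * Complex.I by push_cast; ring, Complex.exp_ofReal_mul_I_im]
  rw [h5, neg_pow τ]
  push_cast
  rw [pow_succ (-1 : ℝ) n]
  linear_combination (-1 : ℝ) ^ n * (Real.Gamma (((n : ℝ) + 1) * α + 1) / (Nat.factorial (n + 1))) *
      Real.sin (((n : ℝ) + 1) * π * α) * h4

lemma exists_mul_rpow_le_mul_add {α : ℝ} (hα0 : 0 < α) (hα1 : α < 1) {τ δ : ℝ} (hτ : 0 < τ)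
    (hδ : 0 < δ) : ∃ C, ∀ r, 0 ≤ r → τ * r ^ α ≤ δ * r + C := by
  have hβ : 0 < 1 - α := by linarith
  set R := (τ / δ) ^ (1 / (1 - α)) with hR
  have hR0 : 0 < R := Real.rpow_pos_of_pos (by positivity) _
  have hRpow : R ^ (1 - α) = τ / δ := by
    rw [hR, ← Real.rpow_mul (by positivity), one_div_mul_cancel hβ.ne', Real.rpow_one]
  refine ⟨τ * R ^ α, fun r hr => ?_⟩
  have hRα : 0 < R ^ α := Real.rpow_pos_of_pos hR0 _
  rcases le_total r R with h | h
  · have : r ^ α ≤ R ^ α := Real.rpow_le_rpow hr h hα0.le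
    have := mul_le_mul_of_nonneg_left this hτ.le
    have : 0 ≤ δ * r := by positivity
    linarith
  · have hr0 : 0 < r := hR0.trans_le h
    have h1 : τ / δ ≤ r ^ (1 - α) := hRpow ▸ Real.rpow_le_rpow hR0.le h hβ.le
    have h2 : r ^ (1 - α) * r ^ α = r := by
      rw [← Real.rpow_add hr0, sub_add_cancel, Real.rpow_one]
    rw [div_le_iff₀ hδ] at h1
    have h3 := mul_le_mul_of_nonneg_right h1 (Real.rpow_nonneg hr α)
    have h4 : r ^ (1 - α) * δ * r ^ α = δ * r := by
      calc r ^ (1 - α) * δ * r ^ α = δ * (r ^ (1 - α) * r ^ α) := by ring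
        _ = δ * r := by rw [h2]
    have : 0 ≤ τ * R ^ α := by positivity
    linarith

/-- The Hankel-type integrand `exp (s - τ s ^ α) ds` in the logarithmic coordinate `s = exp z`, in
which it is entire. -/
noncomputable def logHankel (α τ : ℝ) (z : ℂ) : ℂ :=
  Complex.exp (Complex.exp z - τ * Complex.exp (α * z)) * Complex.exp z

lemma differentiable_logHankel (α τ : ℝ) : Differentiable ℂ (logHankel α τ) := by
  unfold logHankel
  fun_prop

lemma norm_logHankel (α τ u φ : ℝ) :
    ‖logHankel α τ (u + φ * Complex.I)‖ =
      Real.exp (Real.exp u * Real.cos φ - τ * (Real.exp (α * u) * Real.cos (α * φ))) *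
        Real.exp u := by
  rw [logHankel, norm_mul, Complex.norm_exp, Complex.norm_exp, Complex.sub_re, Complex.exp_re,
    Complex.re_ofReal_mul, Complex.exp_re]
  simp

lemma HasDerivAt.im_comp_ofReal_path {P : ℂ → ℂ} {γ : ℝ → ℂ} {P' γ' : ℂ} {t : ℝ}
    (hP : HasDerivAt P P' (γ t)) (hγ : HasDerivAt γ γ' t) :
    HasDerivAt (fun t => (P (γ t)).im) (P' * γ').im t := by
  have h := Complex.imCLM.hasFDerivAt.comp_hasDerivAt t (hP.comp_of_eq t hγ rfl)
  exact h

section Primitive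

variable {α τ : ℝ} {P : ℂ → ℂ}

lemma im_primitive_ofReal (hP : ∀ z, HasDerivAt P (logHankel α τ z) z) (hP0 : P 0 = 0) (u : ℝ) :
    (P u).im = 0 := by
  have h : ∀ x : ℝ, HasDerivAt (fun u : ℝ => (P u).im) 0 x := fun x => by
    have h1 := HasDerivAt.im_comp_ofReal_path (γ := fun u : ℝ => (u : ℂ)) (hP x)
      (Complex.ofRealCLM.hasDerivAt (x := x))
    convert h1 using 1
    rw [Complex.ofRealCLM_apply, Complex.ofReal_one, mul_one, logHankel]
    norm_cast
  have h2 := is_const_of_deriv_eq_zero (fun x => (h x).differentiableAt) (fun x => (h x).deriv) u 0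
  simpa [hP0] using h2

lemma norm_primitive_sub_le (hP : ∀ z, HasDerivAt P (logHankel α τ z) z) {u a b M : ℝ}
    (hM : ∀ φ ∈ Icc a b, ‖logHankel α τ (u + φ * Complex.I)‖ ≤ M) {x y : ℝ} (hx : x ∈ Icc a b)
    (hy : y ∈ Icc a b) :
    ‖P (u + y * Complex.I) - P (u + x * Complex.I)‖ ≤ M * |y - x| := by
  have h : ∀ φ : ℝ, HasDerivAt (fun φ : ℝ => P (u + φ * Complex.I))
      (logHankel α τ (u + φ * Complex.I) * Complex.I) φ := fun φ => by
    have h1 : HasDerivAt (fun φ : ℝ => (u + φ * Complex.I : ℂ)) Complex.I φ := by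
      simpa using ((Complex.ofRealCLM.hasDerivAt (x := φ)).mul_const Complex.I).const_add (u : ℂ)
    exact (hP _).comp_of_eq φ h1 rfl
  exact (convex_Icc a b).norm_image_sub_le_of_norm_hasDerivWithin_le
    (fun φ _ => (h φ).hasDerivWithinAt) (fun φ hφ => by simpa using hM φ hφ) hx hy

lemma norm_logHankel_le (hτ : 0 < τ) (u φ : ℝ) :
    ‖logHankel α τ (u + φ * Complex.I)‖ ≤
      Real.exp (Real.exp u + τ * Real.exp (α * u)) * Real.exp u := by
  rw [norm_logHankel]
  have h1 := mul_le_mul_of_nonneg_left (Real.cos_le_one φ) (Real.exp_pos u).le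
  have h2 := mul_le_mul_of_nonneg_left (Real.neg_one_le_cos (α * φ))
    (mul_pos hτ (Real.exp_pos (α * u))).le
  gcongr
  linarith

lemma tendsto_im_primitive_atBot (hα0 : 0 < α) (hτ : 0 < τ)
    (hP : ∀ z, HasDerivAt P (logHankel α τ z) z) (hP0 : P 0 = 0) :
    Tendsto (fun u : ℝ => (P (u + π * Complex.I)).im) atBot (𝓝 0) := by
  refine squeeze_zero_norm (a := fun u : ℝ =>
    Real.exp (Real.exp u + τ * Real.exp (α * u)) * Real.exp u * π) (fun u => ?_) ?_
  · have h := norm_primitive_sub_le hP (u := u) (a := 0) (b := π)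
      (fun φ _ => norm_logHankel_le hτ u φ) (left_mem_Icc.2 Real.pi_pos.le)
      (right_mem_Icc.2 Real.pi_pos.le)
    rw [sub_zero, abs_of_pos Real.pi_pos, Complex.ofReal_zero, zero_mul, add_zero] at h
    refine le_trans ?_ h
    have h1 := Complex.abs_im_le_norm (P (u + π * Complex.I) - P u)
    rwa [Complex.sub_im, im_primitive_ofReal hP hP0, sub_zero] at h1
  · have h1 : Tendsto (fun u : ℝ => Real.exp (α * u)) atBot (𝓝 0) :=
      Real.tendsto_exp_atBot.comp (tendsto_id.const_mul_atBot hα0)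
    have h2 := (Real.continuous_exp.tendsto _).comp (Real.tendsto_exp_atBot.add (h1.const_mul τ))
    simpa using (h2.mul Real.tendsto_exp_atBot).mul_const π

lemma integrableOn_cut (hα0 : 0 < α) (hα1 : α < 1) (hτ : 0 < τ) :
    IntegrableOn (fun r : ℝ =>
      Complex.exp (-r - τ * (r ^ α : ℝ) * Complex.exp (α * π * Complex.I))) (Ioi 0) := by
  obtain ⟨C, hC⟩ := exists_mul_rpow_le_mul_add hα0 hα1 hτ (half_pos one_pos)
  have hdom : IntegrableOn (fun r : ℝ => Real.exp C * Real.exp (-(1 / 2) * r)) (Ioi 0) :=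
    (exp_neg_integrableOn_Ioi 0 (by norm_num)).const_mul _
  refine hdom.mono' ?_ ((ae_restrict_iff' measurableSet_Ioi).2 (.of_forall fun r (hr : 0 < r) => ?_))
  · refine Continuous.aestronglyMeasurable ?_
    have : Continuous fun r : ℝ => r ^ α := Real.continuous_rpow_const hα0.le
    fun_prop
  · rw [Complex.norm_exp, ← Real.exp_add]
    refine Real.exp_le_exp.2 ?_
    have h1 : (-r - τ * (r ^ α : ℝ) * Complex.exp (α * π * Complex.I) : ℂ).re =
        -r - τ * r ^ α * Real.cos (α * π) := by
      rw [← Complex.ofReal_mul, ← Complex.ofReal_mul, Complex.sub_re, Complex.re_ofReal_mul,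
        Complex.exp_ofReal_mul_I_re, Complex.neg_re, Complex.ofReal_re]
    have h2 := mul_le_mul_of_nonneg_left (Real.neg_one_le_cos (α * π))
      (mul_pos hτ (Real.rpow_pos_of_pos hr α)).le
    have := hC r hr.le
    rw [h1]
    linarith

lemma tendsto_im_primitive_atTop (hα0 : 0 < α) (hα1 : α < 1) (hτ : 0 < τ)
    (hP : ∀ z, HasDerivAt P (logHankel α τ z) z) (hP0 : P 0 = 0) :
    Tendsto (fun u : ℝ => (P (u + π * Complex.I)).im) atTop (𝓝 (π * α * τ * xiα α τ)) := by
  set f' : ℝ → ℝ := fun r =>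
    -(Complex.exp (-r - τ * (r ^ α : ℝ) * Complex.exp (α * π * Complex.I))).im with hf'
  have hinteg : IntegrableOn f' (Ioi 0) := (integrableOn_cut hα0 hα1 hτ).im.neg
  have hderiv : ∀ r : ℝ, 0 < r →
      HasDerivAt (fun r : ℝ => (P (Real.log r + π * Complex.I)).im) (f' r) r := fun r hr => by
    have h1 : HasDerivAt (fun r : ℝ => ((Real.log r : ℝ) + π * Complex.I : ℂ)) ((r⁻¹ : ℝ) : ℂ) r :=
      ((Real.hasDerivAt_log hr.ne').ofReal_comp).add_const _
    convert HasDerivAt.im_comp_ofReal_path (hP _) h1 using 1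
    have h2 : Complex.exp (Real.log r + π * Complex.I) = -r := by
      rw [Complex.exp_add, Complex.exp_pi_mul_I, ← Complex.ofReal_exp, Real.exp_log hr]
      ring
    have h3 : Complex.exp (α * (Real.log r + π * Complex.I)) =
        (r ^ α : ℝ) * Complex.exp (α * π * Complex.I) := by
      rw [mul_add, Complex.exp_add, Real.rpow_def_of_pos hr, Complex.ofReal_exp]
      push_cast
      ring_nf
    have hr' : (r : ℂ) ≠ 0 := by exact_mod_cast hr.ne'
    rw [logHankel, h2, h3]
    simp only [hf']
    rw [← Complex.neg_im]
    congr 1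
    push_cast
    field_simp
  have h0 : Tendsto (fun r : ℝ => (P (Real.log r + π * Complex.I)).im) (𝓝[>] 0) (𝓝 0) :=
    (tendsto_im_primitive_atBot hα0 hτ hP hP0).comp Real.tendsto_log_nhdsGT_zero
  have hval : ∀ b : ℝ, 0 < b → ∫ r in (0 : ℝ)..b, f' r = (P (Real.log b + π * Complex.I)).im :=
    fun b hb => by
    rw [intervalIntegral.integral_eq_sub_of_hasDerivAt_of_tendsto hb (fun r hr => hderiv r hr.1)
      ((intervalIntegrable_iff_integrableOn_Ioc_of_le hb.le).2 (hinteg.mono_set Ioc_subset_Ioi_self))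
      h0 ((hderiv b hb).continuousAt.tendsto.mono_left nhdsWithin_le_nhds), sub_zero]
  have hlim := intervalIntegral_tendsto_integral_Ioi 0 hinteg tendsto_id
  have hL : ∫ r in Ioi (0 : ℝ), f' r = π * α * τ * xiα α τ := by
    rw [xiα_eq_im_integral_cut hα0 hα1 hτ, hf', integral_neg]
    congr 1
    exact (integral_im (𝕜 := ℂ) (integrableOn_cut hα0 hα1 hτ))
  rw [hL] at hlim
  refine (hlim.comp Real.tendsto_exp_atTop).congr fun u => ?_
  simp only [Function.comp, id, hval _ (Real.exp_pos u), Real.log_exp]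

end Primitive

/-- The logarithm of the radius, at angle `φ`, of the curve on which `s - τ s ^ α` is real. -/
noncomputable def logRadius (α τ φ : ℝ) : ℝ :=
  (Real.log τ + Real.log (Real.sin (α * φ)) - Real.log (Real.sin φ)) / (1 - α)

/-- Zolotarev's function for the one-sided stable law of index `α`. -/
noncomputable def zolotarev (α φ : ℝ) : ℝ :=
  Real.exp ((Real.log (Real.sin (α * φ)) - Real.log (Real.sin φ)) / (1 - α)) *
    (Real.sin ((1 - α) * φ) / Real.sin (α * φ))

lemma sin_mul_pos {β φ : ℝ} (hβ0 : 0 < β) (hβ1 : β < 1) (hφ : φ ∈ Ioo 0 π) :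
    0 < Real.sin (β * φ) := by
  have h1 : β * φ < 1 * φ := mul_lt_mul_of_pos_right hβ1 hφ.1
  exact Real.sin_pos_of_pos_of_lt_pi (mul_pos hβ0 hφ.1) (by linarith [hφ.2])

section Curve

variable {α τ φ : ℝ}

lemma zolotarev_pos (hα0 : 0 < α) (hα1 : α < 1) (hφ : φ ∈ Ioo 0 π) : 0 < zolotarev α φ :=
  mul_pos (Real.exp_pos _)
    (div_pos (sin_mul_pos (by linarith) (by linarith) hφ) (sin_mul_pos hα0 hα1 hφ))

lemma exp_logRadius_mul_sin_div (hτ : 0 < τ) :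
    Real.exp (logRadius α τ φ) * (Real.sin ((1 - α) * φ) / Real.sin (α * φ)) =
      zolotarev α φ * τ ^ (1 / (1 - α)) := by
  rw [zolotarev, logRadius, Real.rpow_def_of_pos hτ, mul_right_comm, ← Real.exp_add]
  ring_nf

lemma hasDerivAt_logRadius (hα0 : 0 < α) (hα1 : α < 1) (hφ : φ ∈ Ioo 0 π) :
    HasDerivAt (logRadius α τ)
      ((α * Real.cos (α * φ) / Real.sin (α * φ) - Real.cos φ / Real.sin φ) / (1 - α)) φ := by
  have h1 : HasDerivAt (fun φ => Real.sin (α * φ)) (α * Real.cos (α * φ)) φ := by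
    have := ((hasDerivAt_id φ).const_mul α).sin
    simpa [mul_comm] using this
  exact (((h1.log (sin_mul_pos hα0 hα1 hφ).ne').const_add _).sub
    ((Real.hasDerivAt_sin φ).log (Real.sin_pos_of_mem_Ioo hφ).ne')).div_const _

/-- On the curve, `s - τ s ^ α` is real, equal to `-A(φ) τ ^ (1 / (1 - α))`. -/
lemma logHankel_exponent_eq (hα0 : 0 < α) (hα1 : α < 1) (hτ : 0 < τ) (hφ : φ ∈ Ioo 0 π) :
    Complex.exp (logRadius α τ φ + φ * Complex.I) -
        τ * Complex.exp (α * (logRadius α τ φ + φ * Complex.I)) =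
      ((-(zolotarev α φ * τ ^ (1 / (1 - α))) : ℝ) : ℂ) := by
  have hs := sin_mul_pos hα0 hα1 hφ
  have hs1 := Real.sin_pos_of_mem_Ioo hφ
  have h1 : τ * Real.exp (α * logRadius α τ φ) * Real.sin (α * φ) =
      Real.exp (logRadius α τ φ) * Real.sin φ := by
    nth_rewrite 1 [← Real.exp_log hτ]
    rw [← Real.exp_log hs, ← Real.exp_log hs1, ← Real.exp_add, ← Real.exp_add, ← Real.exp_add]
    congr 1
    have : 1 - α ≠ 0 := by linarith
    rw [logRadius]
    field_simp
    ring
  rw [← exp_logRadius_mul_sin_div hτ]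
  set u := logRadius α τ φ
  apply Complex.ext
  · rw [Complex.sub_re, Complex.re_ofReal_mul, Complex.exp_re, Complex.exp_re, Complex.ofReal_re]
    simp only [Complex.add_re, Complex.mul_re, Complex.add_im, Complex.mul_im, Complex.ofReal_re,
      Complex.ofReal_im, Complex.I_re, Complex.I_im, mul_zero, mul_one, zero_mul, sub_zero, add_zero,
      zero_add]
    have h2 : τ * Real.exp (α * u) = Real.exp u * Real.sin φ / Real.sin (α * φ) := by
      rw [← h1]
      field_simp
    rw [← mul_assoc, h2, sub_mul, one_mul, Real.sin_sub]
    field_simp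
    ring
  · rw [Complex.sub_im, Complex.im_ofReal_mul, Complex.exp_im, Complex.exp_im, Complex.ofReal_im]
    simp only [Complex.add_re, Complex.mul_re, Complex.add_im, Complex.mul_im, Complex.ofReal_re,
      Complex.ofReal_im, Complex.I_re, Complex.I_im, mul_zero, mul_one, zero_mul, sub_zero, add_zero,
      zero_add]
    rw [← mul_assoc, h1, sub_self]

lemma hasDerivAt_im_primitive_curve {P : ℂ → ℂ} (hα0 : 0 < α) (hα1 : α < 1) (hτ : 0 < τ)
    (hP : ∀ z, HasDerivAt P (logHankel α τ z) z) (hφ : φ ∈ Ioo 0 π) :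
    HasDerivAt (fun φ : ℝ => (P (logRadius α τ φ + φ * Complex.I)).im)
      (α / (1 - α) * (zolotarev α φ * τ ^ (1 / (1 - α))) *
        Real.exp (-(zolotarev α φ * τ ^ (1 / (1 - α))))) φ := by
  have hs := sin_mul_pos hα0 hα1 hφ
  have hs1 := Real.sin_pos_of_mem_Ioo hφ
  have hα : 1 - α ≠ 0 := by linarith
  have h1 : HasDerivAt (fun φ : ℝ => (logRadius α τ φ + φ * Complex.I : ℂ))
      (((α * Real.cos (α * φ) / Real.sin (α * φ) - Real.cos φ / Real.sin φ) / (1 - α) : ℝ) +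
        1 * Complex.I) φ :=
    ((hasDerivAt_logRadius hα0 hα1 hφ).ofReal_comp).add
      ((Complex.ofRealCLM.hasDerivAt (x := φ)).mul_const Complex.I)
  convert HasDerivAt.im_comp_ofReal_path (hP _) h1 using 1
  rw [logHankel, logHankel_exponent_eq hα0 hα1 hτ hφ, ← Complex.ofReal_exp, mul_assoc,
    mul_assoc (_ : ℂ), Complex.im_ofReal_mul, Complex.mul_im, Complex.exp_re, Complex.exp_im,
    ← exp_logRadius_mul_sin_div hτ]
  set u := logRadius α τ φ
  simp only [Complex.add_re, Complex.mul_re, Complex.add_im, Complex.mul_im, Complex.ofReal_re,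
    Complex.ofReal_im, Complex.I_re, Complex.I_im, mul_zero, mul_one, sub_zero, add_zero,
    zero_add, Complex.one_re, Complex.one_im]
  rw [sub_mul, one_mul, Real.sin_sub]
  field_simp
  ring

lemma tendsto_im_primitive_curve_zero {P : ℂ → ℂ} (hα0 : 0 < α)
    (hP : ∀ z, HasDerivAt P (logHankel α τ z) z) (hP0 : P 0 = 0) :
    Tendsto (fun φ : ℝ => (P (logRadius α τ φ + φ * Complex.I)).im) (𝓝[>] 0) (𝓝 0) := by
  have hsinc : Tendsto (fun φ : ℝ => Real.log τ + Real.log (α * Real.sinc (α * φ)) -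
      Real.log (Real.sinc φ)) (𝓝 0) (𝓝 (Real.log τ + Real.log (α * Real.sinc (α * 0)) -
      Real.log (Real.sinc 0))) := by
    have hc := Real.continuous_sinc
    refine ContinuousAt.sub (ContinuousAt.add continuousAt_const (ContinuousAt.log ?_ ?_))
      (ContinuousAt.log hc.continuousAt ?_)
    · fun_prop
    · simpa using hα0.ne'
    · simp
  have h1 : Tendsto (logRadius α τ) (𝓝[>] 0) (𝓝 ((Real.log τ + Real.log (α * Real.sinc (α * 0)) -
      Real.log (Real.sinc 0)) / (1 - α))) := by
    refine ((hsinc.mono_left nhdsWithin_le_nhds).div_const (1 - α)).congr' ?_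
    filter_upwards [Ioo_mem_nhdsGT (show (0 : ℝ) < min π (π / α) by positivity)] with φ hφ
    have hφ0 : 0 < φ := hφ.1
    have hφπ : φ < π := hφ.2.trans_le (min_le_left _ _)
    have hφα : φ < π / α := hφ.2.trans_le (min_le_right _ _)
    rw [lt_div_iff₀ hα0] at hφα
    have hs1 := Real.sin_pos_of_pos_of_lt_pi hφ0 hφπ
    have hs := Real.sin_pos_of_pos_of_lt_pi (mul_pos hα0 hφ0) (by linarith)
    rw [logRadius, Real.sinc_of_ne_zero hφ0.ne', Real.sinc_of_ne_zero (mul_pos hα0 hφ0).ne',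
      show α * (Real.sin (α * φ) / (α * φ)) = Real.sin (α * φ) / φ by field_simp,
      Real.log_div hs.ne' hφ0.ne', Real.log_div hs1.ne' hφ0.ne']
    ring
  set l := (Real.log τ + Real.log (α * Real.sinc (α * 0)) - Real.log (Real.sinc 0)) / (1 - α)
  have h2 : Tendsto (fun φ : ℝ => (logRadius α τ φ + φ * Complex.I : ℂ)) (𝓝[>] 0)
      (𝓝 (l + (0 : ℝ) * Complex.I)) :=
    ((Complex.continuous_ofReal.tendsto l).comp h1).add
      (((Complex.continuous_ofReal.tendsto 0).mono_left nhdsWithin_le_nhds).mul_const _)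
  rw [Complex.ofReal_zero, zero_mul, add_zero] at h2
  have h3 := (Complex.continuous_im.tendsto _).comp ((hP l).continuousAt.tendsto.comp h2)
  rwa [im_primitive_ofReal hP hP0] at h3

lemma tendsto_logRadius_pi (hα0 : 0 < α) (hα1 : α < 1) :
    Tendsto (logRadius α τ) (𝓝[<] π) atTop := by
  have hs := Real.sin_pos_of_pos_of_lt_pi (mul_pos hα0 Real.pi_pos)
    (by nlinarith [Real.pi_pos] : α * π < π)
  have h1 : Tendsto (fun φ => Real.log τ + Real.log (Real.sin (α * φ))) (𝓝[<] π)
      (𝓝 (Real.log τ + Real.log (Real.sin (α * π)))) := by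
    refine Tendsto.mono_left (ContinuousAt.add continuousAt_const
      (ContinuousAt.log ?_ hs.ne')) nhdsWithin_le_nhds
    fun_prop
  have h2 : Tendsto Real.sin (𝓝[<] π) (𝓝[>] 0) := by
    refine tendsto_nhdsWithin_iff.2 ⟨?_, ?_⟩
    · simpa using (Real.continuous_sin.tendsto π).mono_left nhdsWithin_le_nhds
    · filter_upwards [Ioo_mem_nhdsLT Real.pi_pos] with φ hφ using Real.sin_pos_of_mem_Ioo hφ
  have h3 : Tendsto (fun φ => -Real.log (Real.sin φ)) (𝓝[<] π) atTop :=
    tendsto_neg_atBot_atTop.comp (Real.tendsto_log_nhdsGT_zero.comp h2)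
  exact (h1.add_atTop h3).atTop_div_const (by linarith)

lemma tendsto_im_primitive_curve_pi {P : ℂ → ℂ} (hα0 : 0 < α) (hα1 : α < 1) (hτ : 0 < τ)
    (hP : ∀ z, HasDerivAt P (logHankel α τ z) z) (hP0 : P 0 = 0) :
    Tendsto (fun φ : ℝ => (P (logRadius α τ φ + φ * Complex.I)).im) (𝓝[<] π)
      (𝓝 (π * α * τ * xiα α τ)) := by
  obtain ⟨C, hC⟩ := exists_mul_rpow_le_mul_add hα0 hα1 hτ (show (0 : ℝ) < 1 / 4 by norm_num)
  have hπ := Real.pi_pos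
  have hlog := tendsto_logRadius_pi (τ := τ) hα0 hα1
  have h1 := (tendsto_im_primitive_atTop hα0 hα1 hτ hP hP0).comp hlog
  have hbound : ∀ u : ℝ, ∀ φ ∈ Icc (π - π / 3) π, ‖logHankel α τ (u + φ * Complex.I)‖ ≤
      Real.exp C * (Real.exp u ^ (1 : ℝ) * Real.exp (-(1 / 4) * Real.exp u)) := fun u φ hφ => by
    have h2 : Real.cos φ ≤ -(1 / 2) := by
      rw [← Real.cos_pi_div_three, ← Real.cos_pi_sub]
      exact Real.cos_le_cos_of_nonneg_of_le_pi (by linarith) hφ.2 hφ.1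
    have h3 := mul_le_mul_of_nonneg_left h2 (Real.exp_pos u).le
    have h4 := mul_le_mul_of_nonneg_left (Real.neg_one_le_cos (α * φ))
      (mul_pos hτ (Real.exp_pos (α * u))).le
    have h5 := hC (Real.exp u) (Real.exp_pos u).le
    rw [← Real.exp_mul, mul_comm u α] at h5
    have h6 : Real.exp C * (Real.exp u ^ (1 : ℝ) * Real.exp (-(1 / 4) * Real.exp u)) =
        Real.exp (C + -(1 / 4) * Real.exp u) * Real.exp u := by
      rw [Real.rpow_one, Real.exp_add]
      ring
    rw [norm_logHankel, h6]
    refine mul_le_mul_of_nonneg_right (Real.exp_le_exp.2 ?_) (Real.exp_pos u).le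
    linarith
  have h2 : Tendsto (fun φ : ℝ => (P (logRadius α τ φ + π * Complex.I)).im -
      (P (logRadius α τ φ + φ * Complex.I)).im) (𝓝[<] π) (𝓝 0) := by
    refine squeeze_zero_norm' (a := fun φ => Real.exp C * (Real.exp (logRadius α τ φ) ^ (1 : ℝ) *
      Real.exp (-(1 / 4) * Real.exp (logRadius α τ φ))) * π) ?_ ?_
    · filter_upwards [Ioo_mem_nhdsLT (show π - π / 3 < π by linarith)] with φ hφ
      have h := norm_primitive_sub_le hP (hbound (logRadius α τ φ)) (Ioo_subset_Icc_self hφ)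
        (right_mem_Icc.2 (by linarith))
      rw [← Complex.sub_im]
      refine (Complex.abs_im_le_norm _).trans (h.trans ?_)
      refine mul_le_mul_of_nonneg_left ?_ (by positivity)
      rw [abs_le]
      constructor <;> linarith [hφ.1, hφ.2]
    · have h3 := ((tendsto_rpow_mul_exp_neg_mul_atTop_nhds_zero 1 (1 / 4) (by norm_num)).comp
        (Real.tendsto_exp_atTop.comp hlog)).const_mul (Real.exp C)
      simpa using h3.mul_const π
  simpa using h1.sub h2

end Curve

/-- A nonnegative derivative on an open interval is integrable as soon as the function has limits at
the endpoints. -/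
lemma intervalIntegrable_of_hasDerivAt_of_nonneg_of_tendsto {f f' : ℝ → ℝ} {a b la lb : ℝ}
    (hab : a < b) (hderiv : ∀ x ∈ Ioo a b, HasDerivAt f (f' x) x) (hpos : ∀ x ∈ Ioo a b, 0 ≤ f' x)
    (ha : Tendsto f (𝓝[>] a) (𝓝 la)) (hb : Tendsto f (𝓝[<] b) (𝓝 lb)) :
    IntervalIntegrable f' volume a b := by
  have hcont : ContinuousOn f (Ioo a b) := fun x hx => (hderiv x hx).continuousAt.continuousWithinAt
  have heq : EqOn (extendFrom (Ioo a b) f) f (Ioo a b) := fun x hx =>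
    extendFrom_eq (subset_closure hx) (hcont x hx)
  refine (intervalIntegrable_iff_integrableOn_Ioc_of_le hab.le).2
    (intervalIntegral.integrableOn_deriv_of_nonneg
      (continuousOn_Icc_extendFrom_Ioo hcont ha hb) (fun x hx => ?_) hpos)
  exact (hderiv x hx).congr_of_eventuallyEq (heq.eventuallyEq_of_mem (Ioo_mem_nhds hx.1 hx.2))

/-- The mixture kernel of the integral representation of `ξ_α`: for each `φ`, it is a Weibull density
in `τ`. -/
noncomputable def weibullKernel (α τ φ : ℝ) : ℝ :=
  zolotarev α φ * (1 / (1 - α) * τ ^ (1 / (1 - α) - 1)) *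
    Real.exp (-(zolotarev α φ * τ ^ (1 / (1 - α))))

lemma measurable_weibullKernel (α : ℝ) :
    Measurable (Function.uncurry (weibullKernel α)) := by
  unfold weibullKernel zolotarev Function.uncurry
  fun_prop

section Kernel

variable {α τ φ : ℝ}

lemma weibullKernel_nonneg (hα0 : 0 < α) (hα1 : α < 1) (hτ : 0 < τ) (hφ : φ ∈ Ioo 0 π) :
    0 ≤ weibullKernel α τ φ := by
  have h1 := zolotarev_pos hα0 hα1 hφ
  have h2 : 0 < 1 - α := by linarith
  unfold weibullKernel
  positivity

/-- Zolotarev's integral representation of `ξ_α`. -/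
lemma integral_weibullKernel_angle (hα0 : 0 < α) (hα1 : α < 1) (hτ : 0 < τ) :
    ∫ φ in Ioo 0 π, weibullKernel α τ φ = π * xiα α τ := by
  obtain ⟨P, hP0, hP⟩ := (differentiable_logHankel α τ).isExactOn_univ.with_val_at 0 0
  replace hP := fun z => hP z (mem_univ z)
  have hβ : 0 < 1 - α := by linarith
  have hderiv := fun φ (hφ : φ ∈ Ioo 0 π) => hasDerivAt_im_primitive_curve hα0 hα1 hτ hP hφ
  have h0 := tendsto_im_primitive_curve_zero (τ := τ) hα0 hP hP0
  have hpi := tendsto_im_primitive_curve_pi hα0 hα1 hτ hP hP0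
  have hpos : ∀ φ ∈ Ioo 0 π, 0 ≤ α / (1 - α) * (zolotarev α φ * τ ^ (1 / (1 - α))) *
        Real.exp (-(zolotarev α φ * τ ^ (1 / (1 - α)))) := fun φ hφ => by
    have h1 := zolotarev_pos hα0 hα1 hφ
    positivity
  have h := intervalIntegral.integral_eq_sub_of_hasDerivAt_of_tendsto Real.pi_pos hderiv
    (intervalIntegrable_of_hasDerivAt_of_nonneg_of_tendsto Real.pi_pos hderiv hpos h0 hpi) h0 hpi
  rw [intervalIntegral.integral_of_le Real.pi_pos.le, integral_Ioc_eq_integral_Ioo] at h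
  have hk : ∀ φ, α / (1 - α) * (zolotarev α φ * τ ^ (1 / (1 - α))) *
        Real.exp (-(zolotarev α φ * τ ^ (1 / (1 - α)))) = α * τ * weibullKernel α τ φ := fun φ => by
    rw [weibullKernel, Real.rpow_sub hτ, Real.rpow_one]
    field_simp
  simp only [hk] at h
  rw [integral_const_mul] at h
  have : α * τ ≠ 0 := by positivity
  apply mul_left_cancel₀ this
  rw [h]
  ring

lemma integrableOn_and_integral_weibullKernel (hα0 : 0 < α) (hα1 : α < 1) (hφ : φ ∈ Ioo 0 π) :
    IntegrableOn (fun τ => weibullKernel α τ φ) (Ioi 0) ∧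
      ∫ τ in Ioi 0, weibullKernel α τ φ = 1 := by
  have hA := zolotarev_pos hα0 hα1 hφ
  have hβ : 0 < 1 / (1 - α) := one_div_pos.2 (by linarith)
  set g : ℝ → ℝ := fun τ => -Real.exp (-(zolotarev α φ * τ ^ (1 / (1 - α)))) with hg
  have hcont : ContinuousWithinAt g (Ici 0) 0 := by
    have : Continuous fun τ : ℝ => τ ^ (1 / (1 - α)) := Real.continuous_rpow_const hβ.le
    exact Continuous.continuousWithinAt (by fun_prop)
  have hderiv : ∀ τ ∈ Ioi (0 : ℝ), HasDerivAt g (weibullKernel α τ φ) τ := fun τ (hτ : 0 < τ) => by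
    have h := ((((Real.hasDerivAt_rpow_const (p := 1 / (1 - α)) (Or.inl hτ.ne')).const_mul
      (zolotarev α φ)).neg).exp).neg
    refine h.congr_deriv ?_
    simp only [weibullKernel, Pi.neg_apply]
    ring
  have hpos : ∀ τ ∈ Ioi (0 : ℝ), 0 ≤ weibullKernel α τ φ := fun τ hτ =>
    weibullKernel_nonneg hα0 hα1 hτ hφ
  have hlim : Tendsto g atTop (𝓝 0) := by
    have h1 : Tendsto (fun τ : ℝ => zolotarev α φ * τ ^ (1 / (1 - α))) atTop atTop :=
      (tendsto_rpow_atTop hβ).const_mul_atTop hA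
    simpa [hg] using (Real.tendsto_exp_neg_atTop_nhds_zero.comp h1).neg
  refine ⟨integrableOn_Ioi_deriv_of_nonneg hcont hderiv hpos hlim, ?_⟩
  rw [integral_Ioi_of_hasDerivAt_of_nonneg hcont hderiv hpos hlim]
  simp only [hg, Real.zero_rpow hβ.ne', mul_zero, neg_zero, Real.exp_zero, sub_neg_eq_add, zero_add]

end Kernel

lemma integrable_weibullKernel {α : ℝ} (hα0 : 0 < α) (hα1 : α < 1) :
    Integrable (Function.uncurry (weibullKernel α))
      ((volume.restrict (Ioi 0)).prod (volume.restrict (Ioo 0 π))) := by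
  refine (integrable_prod_iff' (measurable_weibullKernel α).aestronglyMeasurable).2 ⟨?_, ?_⟩
  · filter_upwards [ae_restrict_mem measurableSet_Ioo] with φ hφ
    exact (integrableOn_and_integral_weibullKernel hα0 hα1 hφ).1
  · refine (integrable_const (1 : ℝ)).congr ?_
    filter_upwards [ae_restrict_mem measurableSet_Ioo] with φ hφ
    rw [← (integrableOn_and_integral_weibullKernel hα0 hα1 hφ).2]
    exact setIntegral_congr_fun measurableSet_Ioi fun τ hτ =>
      (Real.norm_of_nonneg (weibullKernel_nonneg hα0 hα1 hτ hφ)).symm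

/-- For `0 < α < 1`, `ξ_α` is a probability density on `(0,∞)`: it is nonnegative and its
integral over `(0,∞)` equals `1`. -/
theorem xiα_probability_density (α : ℝ) (hα0 : 0 < α) (hα1 : α < 1) :
    (∀ τ ∈ Set.Ioi (0:ℝ), 0 ≤ xiα α τ) ∧
    ∫ τ in Set.Ioi (0:ℝ), xiα α τ = 1 := by
  have hrep : ∀ τ ∈ Ioi (0 : ℝ), xiα α τ = π⁻¹ * ∫ φ in Ioo 0 π, weibullKernel α τ φ :=
    fun τ hτ => by
    rw [integral_weibullKernel_angle hα0 hα1 hτ, inv_mul_cancel_left₀ Real.pi_pos.ne']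
  refine ⟨fun τ hτ => ?_, ?_⟩
  · rw [hrep τ hτ]
    exact mul_nonneg (by positivity) (setIntegral_nonneg measurableSet_Ioo fun φ hφ =>
      weibullKernel_nonneg hα0 hα1 hτ hφ)
  · rw [setIntegral_congr_fun measurableSet_Ioi hrep, integral_const_mul,
      integral_integral_swap (integrable_weibullKernel hα0 hα1),
      setIntegral_congr_fun (g := fun _ => (1 : ℝ)) measurableSet_Ioo fun φ hφ =>
        (integrableOn_and_integral_weibullKernel hα0 hα1 hφ).2]
    simp [Real.pi_pos.le, Real.pi_pos.ne']
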